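/- arXiv:2006.06138 — 2 statements merged into one kernel-verified Lean document; each statement's English description precedes it below -/
import Mathlib

section
/- Suppose in weighted split-CQR that ŵ = w = dQ_X/dP_X, that Q_X is absolutely continuous with respect to P_X, that the non-conformity scores V_1, …, V_n have no ties almost surely, and that (E_{X ~ P_X}[w(X)^ř])^{1/ř} ≤ M_ř < ∞ for some ř ≥ 2. Then there is a positive constant c depending only on M_ř and ř such that 1 − α ≤ P_{(X,Y) ~ Q_X × P_{Y|X}}(Y ∈ Ĉ(X)) ≤ 1 − α + c · n^{1/ř − 1}. -/
open MeasureTheory ProbabilityTheory ENNReal Filter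
open scoped Classical

namespace ConformalCausal

variable {𝒳 : Type*} [MeasurableSpace 𝒳]

/-- Non-conformity score `V = max (q̂_lo(x) − y, y − q̂_hi(x))` of a point `(x, y)`. -/
noncomputable def score (qlo qhi : 𝒳 → ℝ) (p : 𝒳 × ℝ) : ℝ :=
  max (qlo p.1 - p.2) (p.2 - qhi p.1)

/-- The set `{z ∈ ℝ : Σ_{i : V_i ≤ z} p̂_i(x) ≥ 1 − α}` whose infimum is the conformity
correction `η(x)`; here `p̂_i(x) = ŵ(X_i) / (Σ_j ŵ(X_j) + ŵ(x))` (computed in `ℝ≥0∞`, so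
that if `ŵ(x) = ∞` the set is empty, corresponding to `η(x) = +∞`). -/
noncomputable def qSet (α : ℝ) (w : 𝒳 → ℝ≥0∞) {n : ℕ}
    (d : Fin n → 𝒳 × ℝ) (qlo qhi : 𝒳 → ℝ) (x : 𝒳) : Set ℝ :=
  {z | ENNReal.ofReal (1 - α) ≤
      ∑ i, if score qlo qhi (d i) ≤ z
           then w (d i).1 / ((∑ j, w (d j).1) + w x) else 0}

/-- The weighted split-CQR interval `Ĉ(x) = [q̂_lo(x) − η(x), q̂_hi(x) + η(x)]`, equal to
all of `ℝ` when `η(x) = +∞` (i.e. when `qSet` is empty). -/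
noncomputable def Chat (α : ℝ) (w : 𝒳 → ℝ≥0∞) {n : ℕ}
    (d : Fin n → 𝒳 × ℝ) (qlo qhi : 𝒳 → ℝ) (x : 𝒳) : Set ℝ :=
  if (qSet α w d qlo qhi x).Nonempty then
    Set.Icc (qlo x - sInf (qSet α w d qlo qhi x))
            (qhi x + sInf (qSet α w d qlo qhi x))
  else Set.univ

end ConformalCausal

universe u

namespace ConformalCausal

lemma det_lower {ι : Type*} [Fintype ι] (w : ι → ℝ≥0∞) (V : ι → ℝ) (β : ℝ≥0∞) (hβ : β ≤ 1) :
    β * (∑ i, w i) ≤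
      ∑ k, if β * (∑ i, w i) ≤ ∑ i, (if V i < V k then w i else 0) then 0 else w k := by
  set S := ∑ i, w i
  by_cases hB : ∃ k, β * S ≤ ∑ i, (if V i < V k then w i else 0)
  · obtain ⟨k, hk, hmin⟩ := Finset.exists_min_image
      (Finset.univ.filter fun k => β * S ≤ ∑ i, (if V i < V k then w i else 0)) V
      (by obtain ⟨k, hk⟩ := hB; exact ⟨k, by simpa using hk⟩)
    simp only [Finset.mem_filter, Finset.mem_univ, true_and] at hk hmin
    refine hk.trans (Finset.sum_le_sum fun i _ => ?_)
    by_cases h1 : V i < V k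
    · rw [if_pos h1, if_neg]
      intro h2
      exact absurd (hmin i h2) (not_le.2 h1)
    · rw [if_neg h1]; exact zero_le
  · push Not at hB
    calc β * S ≤ 1 * S := by gcongr
      _ = S := one_mul _
      _ = _ := by
        refine Finset.sum_congr rfl fun k _ => ?_
        rw [if_neg (not_le.2 (hB k))]

lemma det_upper {ι : Type*} [Fintype ι] (w : ι → ℝ≥0∞) (V : ι → ℝ) (hV : Function.Injective V)
    (T m : ℝ≥0∞) (hm : ∀ i, w i ≤ m) :
    (∑ k, if T ≤ ∑ i, (if V i < V k then w i else 0) then 0 else w k) ≤ T + m := by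
  by_cases hB : ∃ k, ¬ (T ≤ ∑ i, (if V i < V k then w i else 0))
  · obtain ⟨k, hk, hmax⟩ := Finset.exists_max_image
      (Finset.univ.filter fun k => ¬ (T ≤ ∑ i, (if V i < V k then w i else 0))) V
      (by obtain ⟨k, hk⟩ := hB; exact ⟨k, by simpa using hk⟩)
    simp only [Finset.mem_filter, Finset.mem_univ, true_and] at hk hmax
    calc _ ≤ ∑ i, ((if V i < V k then w i else 0) + (if i = k then w i else 0)) := by
          refine Finset.sum_le_sum fun i _ => ?_
          by_cases h1 : T ≤ ∑ j, (if V j < V i then w j else 0)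
          · rw [if_pos h1]; exact zero_le
          · rw [if_neg h1]
            rcases (hmax i h1).lt_or_eq with h | h
            · rw [if_pos h]; exact le_self_add
            · rw [if_pos (hV h)]; exact le_add_self
      _ = (∑ i, (if V i < V k then w i else 0)) + w k := by
          rw [Finset.sum_add_distrib]; simp
      _ ≤ T + m := add_le_add (not_le.1 hk).le (hm k)
  · push Not at hB
    rw [Finset.sum_eq_zero]
    · exact zero_le
    · intro k _; rw [if_pos (hB k)]

lemma mem_Chat_iff {𝒳 : Type*} [MeasurableSpace 𝒳] (α : ℝ) (hα : α < 1) (w : 𝒳 → ℝ≥0∞) {n : ℕ}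
    (d : Fin n → 𝒳 × ℝ) (qlo qhi : 𝒳 → ℝ) (p : 𝒳 × ℝ) :
    p.2 ∈ Chat α w d qlo qhi p.1 ↔
      ¬ (ENNReal.ofReal (1 - α) ≤ ∑ i, if score qlo qhi (d i) < score qlo qhi p
           then w (d i).1 / ((∑ j, w (d j).1) + w p.1) else 0) := by
  have hβ : 0 < ENNReal.ofReal (1 - α) := by simpa using hα
  set f : Fin n → ℝ≥0∞ := fun i => w (d i).1 / ((∑ j, w (d j).1) + w p.1) with hf
  have hq : ∀ z, z ∈ qSet α w d qlo qhi p.1 ↔ ENNReal.ofReal (1 - α) ≤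
    ∑ i, if score qlo qhi (d i) ≤ z then f i else 0 := fun z => Iff.rfl
  change _ ↔ ¬ (ENNReal.ofReal (1 - α) ≤ ∑ i, if score qlo qhi (d i) < score qlo qhi p
           then f i else 0)
  have key : (ENNReal.ofReal (1 - α) ≤ ∑ i, if score qlo qhi (d i) < score qlo qhi p
           then f i else 0) ↔ ∃ z ∈ qSet α w d qlo qhi p.1, z < score qlo qhi p := by
    constructor
    · intro h
      have hne : (Finset.univ.filter fun i => score qlo qhi (d i) < score qlo qhi p).Nonempty := by
        by_contra hne
        rw [Finset.not_nonempty_iff_eq_empty, Finset.filter_eq_empty_iff] at hne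
        rw [Finset.sum_eq_zero] at h
        · exact absurd h (not_le.2 hβ)
        · intro i hi; rw [if_neg (hne hi)]
      obtain ⟨k, hk, hmax⟩ := Finset.exists_max_image _ (fun i => score qlo qhi (d i)) hne
      simp only [Finset.mem_filter, Finset.mem_univ, true_and] at hk hmax
      refine ⟨score qlo qhi (d k), (hq _).2 (h.trans (Finset.sum_le_sum fun i _ => ?_)), hk⟩
      by_cases h1 : score qlo qhi (d i) < score qlo qhi p
      · rw [if_pos h1, if_pos (hmax i h1)]
      · rw [if_neg h1]; exact zero_le
    · rintro ⟨z, hz, hzp⟩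
      refine ((hq z).1 hz).trans (Finset.sum_le_sum fun i _ => ?_)
      by_cases h1 : score qlo qhi (d i) ≤ z
      · rw [if_pos h1, if_pos (h1.trans_lt hzp)]
      · rw [if_neg h1]; exact zero_le
  rw [key, Chat]
  have hbdd : BddBelow (qSet α w d qlo qhi p.1) := by
    rcases Nat.eq_zero_or_pos n with rfl | hn
    · refine ⟨0, fun z hz => ?_⟩
      have := (hq z).1 hz
      simp at this; linarith
    · obtain ⟨k, -, hmin⟩ := Finset.exists_min_image Finset.univ (fun i => score qlo qhi (d i))
        ⟨(⟨0, hn⟩ : Fin n), Finset.mem_univ _⟩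
      refine ⟨score qlo qhi (d k), fun z hz => ?_⟩
      by_contra hlt
      have h := (hq z).1 hz
      rw [Finset.sum_eq_zero] at h
      · exact absurd h (not_le.2 hβ)
      · intro i hi
        rw [if_neg]
        intro h3
        exact hlt ((hmin i hi).trans h3)
  split_ifs with hne
  · have : p.2 ∈ Set.Icc (qlo p.1 - sInf (qSet α w d qlo qhi p.1))
            (qhi p.1 + sInf (qSet α w d qlo qhi p.1)) ↔
          score qlo qhi p ≤ sInf (qSet α w d qlo qhi p.1) := by
      rw [score, max_le_iff, Set.mem_Icc]
      constructor <;> rintro ⟨h1, h2⟩ <;> constructor <;> linarith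
    rw [this, le_csInf_iff hbdd hne]
    push Not
    rfl
  · rw [Set.not_nonempty_iff_eq_empty] at hne
    simp [hne]

end ConformalCausal

namespace ConformalCausal

open scoped Classical in
/-- Coverage event, in terms of the leave-one-out weighted rank. -/
def covSet {𝒳 : Type*} (β : ℝ≥0∞) (w : 𝒳 → ℝ≥0∞) (V : 𝒳 × ℝ → ℝ) (n : ℕ) :
    Set ((Fin n → 𝒳 × ℝ) × (𝒳 × ℝ)) :=
  {ω | ¬ (β ≤ ∑ i, if V (ω.1 i) < V ω.2
      then w (ω.1 i).1 / ((∑ j, w (ω.1 j).1) + w ω.2.1) else 0)}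

lemma measurableSet_covSet {𝒳 : Type*} [MeasurableSpace 𝒳] (β : ℝ≥0∞) (w : 𝒳 → ℝ≥0∞)
    (hw : Measurable w) (V : 𝒳 × ℝ → ℝ) (hV : Measurable V) (n : ℕ) :
    MeasurableSet (covSet β w V n) := by
  unfold covSet
  refine MeasurableSet.compl (s := {ω : (Fin n → 𝒳 × ℝ) × (𝒳 × ℝ) |
    β ≤ ∑ i, if V (ω.1 i) < V ω.2
      then w (ω.1 i).1 / ((∑ j, w (ω.1 j).1) + w ω.2.1) else 0}) ?_
  refine measurableSet_le measurable_const ?_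
  refine Finset.measurable_sum _ fun i _ => ?_
  refine Measurable.ite (measurableSet_lt (by fun_prop) (by fun_prop)) ?_ measurable_const
  fun_prop

lemma compProd_eq_withDensity {𝒳 : Type*} [MeasurableSpace 𝒳] (P Q : Measure 𝒳)
    [IsProbabilityMeasure P] [IsProbabilityMeasure Q] (K : Kernel 𝒳 ℝ) [IsMarkovKernel K]
    (w : 𝒳 → ℝ≥0∞) (hw : Measurable w) (hwQ : ∀ᵐ x ∂P, w x = Q.rnDeriv P x) (hQP : Q ≪ P) :
    Q ⊗ₘ K = (P ⊗ₘ K).withDensity (fun p => w p.1) := by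
  have hQ : Q = P.withDensity w := by
    rw [withDensity_congr_ae hwQ, Measure.withDensity_rnDeriv_eq _ _ hQP]
  ext s hs
  have hK : Measurable fun a => K a (Prod.mk a ⁻¹' s) := Kernel.measurable_kernel_prodMk_left hs
  rw [Measure.compProd_apply hs, withDensity_apply _ hs, ← lintegral_indicator hs,
    Measure.lintegral_compProd (f := s.indicator (fun p : 𝒳 × ℝ => w p.1))
      ((hw.comp measurable_fst).indicator hs)]
  conv_lhs => rw [hQ]
  rw [lintegral_withDensity_eq_lintegral_mul _ hw hK]
  refine lintegral_congr fun a => ?_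
  have hsa : MeasurableSet (Prod.mk a ⁻¹' s) := measurable_prodMk_left hs
  have : ∀ b, s.indicator (fun p : 𝒳 × ℝ => w p.1) (a, b)
      = (Prod.mk a ⁻¹' s).indicator (fun _ => w a) b := fun b => by
    simp [Set.indicator]
  simp only [this, Pi.mul_apply]
  rw [lintegral_indicator hsa, lintegral_const]
  simp

lemma measure_covSet_eq {𝒳 : Type*} [MeasurableSpace 𝒳] (μ ν : Measure (𝒳 × ℝ))
    [IsProbabilityMeasure μ] [IsProbabilityMeasure ν] (w : 𝒳 → ℝ≥0∞) (hw : Measurable w)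
    (hν : ν = μ.withDensity (fun p => w p.1)) (n : ℕ)
    (E : Set ((Fin n → 𝒳 × ℝ) × (𝒳 × ℝ))) (hE : MeasurableSet E) (k : Fin (n + 1)) :
    ((Measure.pi fun _ : Fin n => μ).prod ν) E =
      ∫⁻ d, w (d k).1 * E.indicator 1 (fun i => d (k.succAbove i), d k)
        ∂(Measure.pi fun _ : Fin (n + 1) => μ) := by
  have h1 : Measurable (E.indicator (1 : (Fin n → 𝒳 × ℝ) × (𝒳 × ℝ) → ℝ≥0∞)) := measurable_one.indicator hE
  have hG : Measurable fun ω : (𝒳 × ℝ) × (Fin n → 𝒳 × ℝ) =>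
      w ω.1.1 * E.indicator 1 (ω.2, ω.1) :=
    (hw.comp (measurable_fst.comp measurable_fst)).mul (h1.comp measurable_swap)
  have hmp := measurePreserving_piFinSuccAbove (fun _ : Fin (n + 1) => μ) k
  have e := hmp.lintegral_comp hG
  refine Eq.trans ?_ (e.symm.trans (lintegral_congr fun d => ?_))
  · rw [lintegral_prod_symm' _ hG, ← lintegral_indicator_one hE, lintegral_prod _ h1.aemeasurable]
    refine lintegral_congr fun d => ?_
    rw [hν]
    exact lintegral_withDensity_eq_lintegral_mul μ (hw.comp measurable_fst)
      (h1.comp measurable_prodMk_left)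
  · rfl

lemma sum_pointwise {𝒳 : Type*} (β : ℝ≥0∞) (w : 𝒳 → ℝ≥0∞)
    (V : 𝒳 × ℝ → ℝ) (n : ℕ) (d : Fin (n + 1) → 𝒳 × ℝ) (hfin : ∀ i, w (d i).1 ≠ ∞) :
    (∑ k, w (d k).1 * (covSet β w V n).indicator 1 (fun i => d (k.succAbove i), d k)) =
      ∑ k, if β * (∑ i, w (d i).1) ≤ ∑ i, (if V (d i) < V (d k) then w (d i).1 else 0)
        then 0 else w (d k).1 := by
  refine Finset.sum_congr rfl fun k _ => ?_
  by_cases h0 : w (d k).1 = 0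
  · simp [h0]
  set S := ∑ i, w (d i).1 with hS
  have hS0 : S ≠ 0 := fun h => h0 (by
    rw [hS, Finset.sum_eq_zero_iff] at h
    exact h k (Finset.mem_univ _))
  have hStop : S ≠ ∞ := ENNReal.sum_ne_top.2 fun i _ => hfin i
  have hSk : (∑ j, w (d (k.succAbove j)).1) + w (d k).1 = S := by
    rw [hS, Fin.sum_univ_succAbove _ k, add_comm]
  have hmem : ((fun i => d (k.succAbove i), d k) ∈ covSet β w V n) ↔
      ¬ (β * S ≤ ∑ i, (if V (d i) < V (d k) then w (d i).1 else 0)) := by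
    unfold covSet
    rw [Set.mem_ofPred_eq]
    dsimp only
    rw [hSk, not_iff_not, ← ENNReal.le_div_iff_mul_le (Or.inl hS0) (Or.inl hStop),
      Fin.sum_univ_succAbove _ k, if_neg (lt_irrefl _), zero_add, div_eq_mul_inv, Finset.sum_mul]
    have : ∀ i, (if V (d (k.succAbove i)) < V (d k) then w (d (k.succAbove i)).1 / S else 0)
      = (if V (d (k.succAbove i)) < V (d k) then w (d (k.succAbove i)).1 else 0) * S⁻¹ := by
      intro i
      split_ifs <;> simp [div_eq_mul_inv]
    simp only [this]
  by_cases hc : β * S ≤ ∑ i, (if V (d i) < V (d k) then w (d i).1 else 0)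
  · rw [if_pos hc, Set.indicator_of_notMem (by rw [hmem]; exact not_not.2 hc), mul_zero]
  · rw [if_neg hc, Set.indicator_of_mem (hmem.2 hc), Pi.one_apply, mul_one]

lemma jensen_rpow {Ω : Type*} [MeasurableSpace Ω] (μ : Measure Ω) [IsProbabilityMeasure μ]
    (r : ℝ) (hr : 2 ≤ r) (f : Ω → ℝ≥0∞) (hf : Measurable f) :
    ∫⁻ x, f x ^ (1 / r) ∂μ ≤ (∫⁻ x, f x ∂μ) ^ (1 / r) := by
  have hc : r.HolderConjugate (Real.conjExponent r) :=
    Real.HolderConjugate.conjExponent (by linarith)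
  have := ENNReal.lintegral_mul_le_Lp_mul_Lq μ hc (f := fun x => f x ^ (1 / r)) (g := fun _ => 1)
    (by fun_prop) (by fun_prop)
  have hr0 : r ≠ 0 := by linarith
  simpa [← ENNReal.rpow_mul, hr0] using this

lemma noties {Z : Type*} [MeasurableSpace Z] (μ : Measure Z) [IsProbabilityMeasure μ]
    (V : Z → ℝ) (hV : Measurable V) (n : ℕ) (hn : 2 ≤ n)
    (h : (Measure.pi fun _ : Fin n => μ) {d | ∃ i j : Fin n, i ≠ j ∧ V (d i) = V (d j)} = 0)
    (m : ℕ) : ∀ᵐ d ∂(Measure.pi fun _ : Fin m => μ), Function.Injective fun i => V (d i) := by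
  have hmap : ∀ (l : ℕ) (i j : Fin l), i ≠ j →
      (Measure.pi fun _ : Fin l => μ).map (fun d => (d i, d j)) = μ.prod μ := by
    intro l i j hij
    have hind := (iIndepFun_pi (μ := fun _ : Fin l => μ) (X := fun _ => id)
      (fun _ => aemeasurable_id)).indepFun hij
    have := (indepFun_iff_map_prod_eq_prod_map_map
      (measurable_pi_apply i).aemeasurable (measurable_pi_apply j).aemeasurable).1 hind
    refine this.trans ?_
    have e1 := (measurePreserving_eval (fun _ : Fin l => μ) i).map_eq
    have e2 := (measurePreserving_eval (fun _ : Fin l => μ) j).map_eq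
    exact congrArg₂ Measure.prod e1 e2
  have hT : MeasurableSet {p : Z × Z | V p.1 = V p.2} :=
    measurableSet_eq_fun (by fun_prop) (by fun_prop)
  have h2 : (μ.prod μ) {p : Z × Z | V p.1 = V p.2} = 0 := by
    have hne : (⟨0, by omega⟩ : Fin n) ≠ ⟨1, by omega⟩ := by simp
    rw [← hmap n _ _ hne, Measure.map_apply (by fun_prop) hT]
    refine measure_mono_null ?_ h
    intro d hd
    exact ⟨_, _, hne, hd⟩
  have h3 : ∀ i j : Fin m, ∀ᵐ d ∂(Measure.pi fun _ : Fin m => μ), i ≠ j → V (d i) ≠ V (d j) := by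
    intro i j
    by_cases hij : i = j
    · simp [hij]
    · rw [← hmap m i j hij, Measure.map_apply (by fun_prop) hT] at h2
      rw [ae_iff]
      refine measure_mono_null (fun d hd => ?_) h2
      simp only [Set.mem_ofPred_eq, Classical.not_imp, not_not] at hd
      exact hd.2
  have h4 := ae_all_iff.2 fun i => ae_all_iff.2 (h3 i)
  filter_upwards [h4] with d hd i j hij
  by_contra hne
  exact hd i j hne hij

end ConformalCausal

namespace ConformalCausal

lemma lintegral_eval {Z : Type*} [MeasurableSpace Z] (μ : Measure Z) [IsProbabilityMeasure μ]
    (m : ℕ) (k : Fin m) (g : Z → ℝ≥0∞) (hg : Measurable g) :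
    ∫⁻ d, g (d k) ∂(Measure.pi fun _ : Fin m => μ) = ∫⁻ z, g z ∂μ :=
  (measurePreserving_eval (fun _ : Fin m => μ) k).lintegral_comp hg

lemma cov_bounds {𝒳 : Type*} [MeasurableSpace 𝒳] (μ ν : Measure (𝒳 × ℝ))
    [IsProbabilityMeasure μ] [IsProbabilityMeasure ν] (w : 𝒳 → ℝ≥0∞) (hw : Measurable w)
    (hν : ν = μ.withDensity (fun p => w p.1)) (V : 𝒳 × ℝ → ℝ) (hV : Measurable V)
    (β : ℝ≥0∞) (hβ : β ≤ 1) (n : ℕ) :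
    β ≤ ((Measure.pi fun _ : Fin n => μ).prod ν) (covSet β w V n) ∧
    ∀ (r : ℝ), 2 ≤ r →
      (∀ᵐ d ∂(Measure.pi fun _ : Fin (n + 1) => μ), Function.Injective fun i => V (d i)) →
      ((n : ℝ≥0∞) + 1) * ((Measure.pi fun _ : Fin n => μ).prod ν) (covSet β w V n) ≤
        ((n : ℝ≥0∞) + 1) * β +
          ((n : ℝ≥0∞) + 1) ^ (1 / r) * (∫⁻ p, w p.1 ^ r ∂μ) ^ (1 / r) := by
  have hwm : Measurable fun p : 𝒳 × ℝ => w p.1 := by fun_prop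
  have hint : ∫⁻ p, w p.1 ∂μ = 1 := by
    have : ν Set.univ = 1 := measure_univ
    rwa [hν, withDensity_apply _ MeasurableSet.univ, Measure.restrict_univ] at this
  have hE := measurableSet_covSet β w hw V hV n
  have hfin0 : ∀ᵐ p ∂μ, w p.1 ≠ ∞ := by
    filter_upwards [ae_lt_top hwm (by rw [hint]; simp)] with p hp using hp.ne
  have hfin : ∀ᵐ d ∂(Measure.pi fun _ : Fin (n + 1) => μ), ∀ i, w (d i).1 ≠ ∞ :=
    ae_all_iff.2 fun i =>
      (measurePreserving_eval (fun _ : Fin (n + 1) => μ) i).quasiMeasurePreserving.ae hfin0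
  have hmeas : ∀ k : Fin (n + 1), Measurable fun d : Fin (n + 1) → 𝒳 × ℝ => w (d k).1 *
      (covSet β w V n).indicator (1 : _ × _ → ℝ≥0∞) (fun i => d (k.succAbove i), d k) := by
    intro k
    have h1 : Measurable ((covSet β w V n).indicator (1 : _ × _ → ℝ≥0∞)) :=
      measurable_one.indicator hE
    have h2 : Measurable fun d : Fin (n + 1) → 𝒳 × ℝ =>
      ((fun i => d (k.succAbove i), d k) : (Fin n → 𝒳 × ℝ) × (𝒳 × ℝ)) := by fun_prop
    have h3 : Measurable fun d : Fin (n + 1) → 𝒳 × ℝ => w (d k).1 := by fun_prop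
    exact h3.mul (h1.comp h2)
  set A := ((Measure.pi fun _ : Fin n => μ).prod ν) (covSet β w V n) with hA
  have hsum : ((n : ℝ≥0∞) + 1) * A = ∫⁻ d, (∑ k, if β * (∑ i, w (d i).1) ≤
      ∑ i, (if V (d i) < V (d k) then w (d i).1 else 0) then 0 else w (d k).1)
        ∂(Measure.pi fun _ : Fin (n + 1) => μ) := by
    have : ((n : ℝ≥0∞) + 1) * A = ∑ _k : Fin (n + 1), A := by simp
    rw [this, Finset.sum_congr rfl fun k _ => measure_covSet_eq μ ν w hw hν n _ hE k,
      ← lintegral_finsetSum _ fun k _ => hmeas k]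
    refine lintegral_congr_ae ?_
    filter_upwards [hfin] with d hd using sum_pointwise β w V n d hd
  have hS : ∫⁻ d, β * (∑ i, w (d i).1) ∂(Measure.pi fun _ : Fin (n + 1) => μ)
      = ((n : ℝ≥0∞) + 1) * β := by
    rw [lintegral_const_mul _ (by fun_prop), lintegral_finsetSum _ (fun k _ => by fun_prop),
      Finset.sum_congr rfl fun k _ => lintegral_eval μ (n + 1) k _ hwm, hint]
    simp [mul_comm]
  constructor
  · have : ((n : ℝ≥0∞) + 1) * β ≤ ((n : ℝ≥0∞) + 1) * A := by
      rw [hsum, ← hS]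
      exact lintegral_mono fun d => det_lower (fun i => w (d i).1) (fun i => V (d i)) β hβ
    exact (ENNReal.mul_le_mul_iff_right (by simp) (by simp)).1 this
  · intro r hr hinj
    have hr0 : 0 < r := by linarith
    rw [hsum, ← hS]
    calc _ ≤ ∫⁻ d, (β * (∑ i, w (d i).1) + (∑ i, w (d i).1 ^ r) ^ (1 / r))
              ∂(Measure.pi fun _ : Fin (n + 1) => μ) := by
          refine lintegral_mono_ae ?_
          filter_upwards [hinj] with d hd
          refine det_upper (fun i => w (d i).1) (fun i => V (d i)) hd _ _ fun k => ?_
          calc w (d k).1 = (w (d k).1 ^ r) ^ (1 / r) := by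
                rw [← ENNReal.rpow_mul, mul_one_div_cancel hr0.ne', ENNReal.rpow_one]
            _ ≤ _ := by
                refine ENNReal.rpow_le_rpow ?_ (by positivity)
                exact Finset.single_le_sum (f := fun i => w (d i).1 ^ r)
                  (fun i _ => zero_le) (Finset.mem_univ k)
      _ = _ + ∫⁻ d, (∑ i, w (d i).1 ^ r) ^ (1 / r) ∂(Measure.pi fun _ : Fin (n + 1) => μ) :=
          lintegral_add_left (by fun_prop) _
      _ ≤ _ := by
          gcongr
          refine (jensen_rpow _ r hr _ (by fun_prop)).trans (le_of_eq ?_)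
          rw [lintegral_finsetSum _ (fun k _ => by fun_prop),
            Finset.sum_congr rfl fun k _ => lintegral_eval μ (n + 1) k
              (fun p => w p.1 ^ r) (by fun_prop),
            ← ENNReal.mul_rpow_of_nonneg _ _ (by positivity)]
          simp

end ConformalCausal

/-- Proposition 1 (2): suppose `ŵ = w = dQ_X/dP_X`, `Q_X ≪ P_X`, the
non-conformity scores have no ties almost surely, and `(E_{X~P_X}[w(X)^ř])^{1/ř} ≤ M_ř < ∞`
for some `ř ≥ 2`.  Then there is a constant `c > 0` depending only on `M_ř` and `ř` with
`1 − α ≤ P_{(X,Y) ~ Q_X × P_{Y|X}}(Y ∈ Ĉ(X)) ≤ 1 − α + c · n^{1/ř − 1}`. -/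
theorem weighted_split_CQR_coverage_two_sided (rr M : ℝ) (hrr : 2 ≤ rr) (hM : 0 < M) :
    ∃ c : ℝ, 0 < c ∧
      ∀ {𝒳 : Type u} [MeasurableSpace 𝒳]
        (P Q : Measure 𝒳), ∀ [IsProbabilityMeasure P] [IsProbabilityMeasure Q],
        ∀ (K : Kernel 𝒳 ℝ), ∀ [IsMarkovKernel K],
        ∀ (α : ℝ), α ∈ Set.Ioo (0 : ℝ) 1 →
        ∀ (qlo qhi : 𝒳 → ℝ), Measurable qlo → Measurable qhi →
        ∀ (w : 𝒳 → ℝ≥0∞), Measurable w →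
        -- `ŵ = w` is (a version of) the likelihood ratio `dQ_X/dP_X`
        (∀ᵐ x ∂P, w x = Q.rnDeriv P x) →
        -- `Q_X` is absolutely continuous with respect to `P_X`
        Q ≪ P →
        -- moment bound on the likelihood ratio
        (∫⁻ x, w x ^ rr ∂P) ^ (1 / rr) ≤ ENNReal.ofReal M →
        ∀ n : ℕ, 0 < n →
        -- the non-conformity scores have no ties almost surely
        ((Measure.pi fun _ : Fin n => P ⊗ₘ K)
          {d : Fin n → 𝒳 × ℝ | ∃ i j : Fin n, i ≠ j ∧
            ConformalCausal.score qlo qhi (d i) = ConformalCausal.score qlo qhi (d j)} = 0) →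
        1 - α ≤
            (((Measure.pi fun _ : Fin n => P ⊗ₘ K).prod (Q ⊗ₘ K))
              {ω : (Fin n → 𝒳 × ℝ) × (𝒳 × ℝ) |
                ω.2.2 ∈ ConformalCausal.Chat α w ω.1 qlo qhi ω.2.1}).toReal ∧
          (((Measure.pi fun _ : Fin n => P ⊗ₘ K).prod (Q ⊗ₘ K))
              {ω : (Fin n → 𝒳 × ℝ) × (𝒳 × ℝ) |
                ω.2.2 ∈ ConformalCausal.Chat α w ω.1 qlo qhi ω.2.1}).toReal ≤
            1 - α + c * (n : ℝ) ^ (1 / rr - 1) := by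
  refine ⟨max M 1, by positivity, ?_⟩
  intro 𝒳 _ P Q _ _ K _ α hα qlo qhi hqlo hqhi w hw hwQ hQP hmom n hn hties
  have hν := ConformalCausal.compProd_eq_withDensity P Q K w hw hwQ hQP
  have hV : Measurable (ConformalCausal.score qlo qhi) := by
    unfold ConformalCausal.score
    fun_prop
  have hset : {ω : (Fin n → 𝒳 × ℝ) × (𝒳 × ℝ) |
      ω.2.2 ∈ ConformalCausal.Chat α w ω.1 qlo qhi ω.2.1} =
      ConformalCausal.covSet (ENNReal.ofReal (1 - α)) w (ConformalCausal.score qlo qhi) n := by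
    ext ω
    exact ConformalCausal.mem_Chat_iff α hα.2 w ω.1 qlo qhi ω.2
  rw [hset]
  have hβ : ENNReal.ofReal (1 - α) ≤ 1 := by
    rw [ENNReal.ofReal_le_one]; linarith [hα.1]
  obtain ⟨hlow, hup⟩ := ConformalCausal.cov_bounds (P ⊗ₘ K) (Q ⊗ₘ K) w hw hν _ hV _ hβ n
  set A := ((Measure.pi fun _ : Fin n => P ⊗ₘ K).prod (Q ⊗ₘ K))
    (ConformalCausal.covSet (ENNReal.ofReal (1 - α)) w (ConformalCausal.score qlo qhi) n)
  have hA1 : A ≤ 1 := prob_le_one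
  have hAtop : A ≠ ∞ := ne_top_of_le_ne_top one_ne_top hA1
  refine ⟨(ENNReal.ofReal_le_iff_le_toReal hAtop).1 hlow, ?_⟩
  rcases Nat.lt_or_ge n 2 with h2 | h2
  · obtain rfl : n = 1 := by omega
    have h3 : A.toReal ≤ 1 := by
      simpa using ENNReal.toReal_mono one_ne_top hA1
    have h4 := le_max_right M 1
    simp only [Nat.cast_one, Real.one_rpow, mul_one]
    linarith [hα.2]
  have hinj := ConformalCausal.noties (P ⊗ₘ K) _ hV n h2 hties (n + 1)
  have h5 := hup rr hrr hinj
  have h6 : ∫⁻ p, w p.1 ^ rr ∂(P ⊗ₘ K) = ∫⁻ x, w x ^ rr ∂P := by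
    rw [Measure.lintegral_compProd (f := fun p : 𝒳 × ℝ => w p.1 ^ rr) (by fun_prop)]
    simp
  rw [h6] at h5
  have h7 := h5.trans (add_le_add_right (mul_le_mul_right hmom (((n : ℝ≥0∞) + 1) ^ (1 / rr))) _)
  have hN : (n : ℝ≥0∞) + 1 = ENNReal.ofReal ((n : ℝ) + 1) := by
    rw [ENNReal.ofReal_add (by positivity) zero_le_one]; simp
  have hα1 : 0 ≤ 1 - α := by linarith [hα.2]
  rw [hN, ENNReal.ofReal_rpow_of_pos (by positivity), ← ENNReal.ofReal_mul (by positivity),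
    ← ENNReal.ofReal_mul (by positivity), ← ENNReal.ofReal_add (by positivity) (by positivity),
    ← ENNReal.ofReal_toReal hAtop, ← ENNReal.ofReal_mul (by positivity),
    ENNReal.ofReal_le_ofReal_iff (by positivity)] at h7
  have hnpos : (0 : ℝ) < n := by exact_mod_cast hn
  have h8 : ((n : ℝ) + 1) ^ (1 / rr) = ((n : ℝ) + 1) * ((n : ℝ) + 1) ^ (1 / rr - 1) := by
    rw [Real.rpow_sub_one (by positivity)]
    field_simp
  rw [h8] at h7
  have h9 : A.toReal ≤ (1 - α) + ((n : ℝ) + 1) ^ (1 / rr - 1) * M := by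
    refine le_of_mul_le_mul_left (h7.trans (le_of_eq ?_)) (by positivity : (0 : ℝ) < (n : ℝ) + 1)
    ring
  have h10 : ((n : ℝ) + 1) ^ (1 / rr - 1) ≤ (n : ℝ) ^ (1 / rr - 1) := by
    refine Real.rpow_le_rpow_of_nonpos hnpos (by linarith) ?_
    have : 1 / rr ≤ 1 := by
      rw [div_le_one (by linarith)]; linarith
    linarith
  have h11 : ((n : ℝ) + 1) ^ (1 / rr - 1) * M ≤ max M 1 * (n : ℝ) ^ (1 / rr - 1) := by
    rw [mul_comm]
    exact mul_le_mul (le_max_left _ _) h10 (by positivity) (by positivity)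
  linarith
end

section
/- Coverage under the tilted covariate distribution: in weighted split-CQR with an arbitrary measurable weight function ŵ : 𝒳 → [0,∞) satisfying E_{X ~ P_X}[ŵ(X)] = 1, define the tilted probability measure Q̃_X on 𝒳 by dQ̃_X = ŵ dP_X. Then for a test pair (X̃, Ỹ) ~ Q̃_X × P_{Y|X} independent of the calibration sample, the weighted split-CQR interval built with weight function ŵ satisfies P(Ỹ ∈ Ĉ(X̃)) ≥ 1 − α. -/
open MeasureTheory ProbabilityTheory ENNReal Filter
open scoped Classical

namespace ConformalCausal

variable {𝒳 : Type*} [MeasurableSpace 𝒳]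

/-- Deterministic core: the weight of the indices `k` for which the weight of strictly smaller
scores is below `c * S` is at least `c * S`. -/
lemma sum_good_ge {m : ℕ} (c : ℝ≥0∞) (hc : c ≤ 1) (w : Fin m → ℝ≥0∞) (V : Fin m → ℝ) :
    c * ∑ j, w j ≤
      ∑ k, if (∑ i, if V i < V k then w i else 0) < c * ∑ j, w j then w k else 0 := by
  by_cases h : ∃ k, c * ∑ j, w j ≤ ∑ i, if V i < V k then w i else 0
  · obtain ⟨k, hk, hmin⟩ := (Finset.univ.filter fun k =>
      c * ∑ j, w j ≤ ∑ i, if V i < V k then w i else 0).exists_min_image V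
        (by obtain ⟨k, hk⟩ := h; exact ⟨k, by simpa using hk⟩)
    rw [Finset.mem_filter] at hk
    refine hk.2.trans (Finset.sum_le_sum fun i _ => ?_)
    by_cases hi : V i < V k
    · have : (∑ j, if V j < V i then w j else 0) < c * ∑ j, w j := by
        by_contra hcon
        exact absurd (hmin i (by simpa using hcon)) (not_le.2 hi)
      rw [if_pos hi, if_pos this]
    · simp [hi]
  · push Not at h
    simp only [h, if_true]
    calc c * ∑ j, w j ≤ 1 * ∑ j, w j := by gcongr
      _ = _ := one_mul _

/-- The good event for a test point `z` and calibration data `d`. -/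
def goodEvent (c : ℝ≥0∞) (w : 𝒳 → ℝ≥0∞) (qlo qhi : 𝒳 → ℝ) (n : ℕ) :
    Set ((𝒳 × ℝ) × (Fin n → 𝒳 × ℝ)) :=
  {p | (∑ i, if score qlo qhi (p.2 i) < score qlo qhi p.1 then w (p.2 i).1 else 0)
      < c * ((∑ j, w (p.2 j).1) + w p.1.1)}

lemma measurable_score {qlo qhi : 𝒳 → ℝ} (hqlo : Measurable qlo) (hqhi : Measurable qhi) :
    Measurable (score qlo qhi) := by
  unfold score
  fun_prop

lemma measurableSet_goodEvent (c : ℝ≥0∞) {w : 𝒳 → ℝ≥0∞} (hw : Measurable w)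
    {qlo qhi : 𝒳 → ℝ} (hqlo : Measurable qlo) (hqhi : Measurable qhi) (n : ℕ) :
    MeasurableSet (goodEvent c w qlo qhi n) := by
  have hs := measurable_score hqlo hqhi
  unfold goodEvent
  refine measurableSet_lt (Finset.measurable_sum _ fun i _ => Measurable.ite ?_ ?_ ?_) ?_
  · exact measurableSet_lt (by fun_prop) (by fun_prop)
  · fun_prop
  · fun_prop
  · fun_prop

lemma mem_Chat_of_good {α : ℝ} {w : 𝒳 → ℝ≥0∞} {qlo qhi : 𝒳 → ℝ} {n : ℕ}
    {z : 𝒳 × ℝ} {d : Fin n → 𝒳 × ℝ}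
    (h : (z, d) ∈ goodEvent (ENNReal.ofReal (1 - α)) w qlo qhi n) :
    z.2 ∈ Chat α w d qlo qhi z.1 := by
  unfold Chat
  split_ifs with hne
  · have key : score qlo qhi z ≤ sInf (qSet α w d qlo qhi z.1) := by
      refine le_csInf hne fun t ht => ?_
      by_contra hlt
      rw [not_le] at hlt
      simp only [goodEvent, Set.mem_ofPred_eq] at h
      refine absurd h (not_lt.2 ?_)
      have ht' : ENNReal.ofReal (1 - α) ≤
          (∑ i, if score qlo qhi (d i) ≤ t then w (d i).1 else 0) /
            ((∑ j, w (d j).1) + w z.1) := by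
        refine le_of_le_of_eq ht ?_
        rw [div_eq_mul_inv, Finset.sum_mul]
        refine Finset.sum_congr rfl fun i _ => ?_
        split_ifs <;> simp [div_eq_mul_inv]
      refine (ENNReal.mul_le_of_le_div ht').trans (Finset.sum_le_sum fun i _ => ?_)
      by_cases hi : score qlo qhi (d i) ≤ t
      · rw [if_pos hi, if_pos (hi.trans_lt hlt)]
      · simp [hi]
    have h1 := (le_max_left _ _).trans key
    have h2 := (le_max_right _ _).trans key
    constructor <;> linarith
  · trivial

lemma compProd_withDensity_left (P : Measure 𝒳) [IsProbabilityMeasure P]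
    (K : Kernel 𝒳 ℝ) [IsMarkovKernel K] {w : 𝒳 → ℝ≥0∞} (hw : Measurable w) :
    (P.withDensity w) ⊗ₘ K = (P ⊗ₘ K).withDensity fun z => w z.1 := by
  refine Measure.ext_of_lintegral _ fun φ hφ => ?_
  rw [Measure.lintegral_compProd hφ,
    lintegral_withDensity_eq_lintegral_mul _ hw hφ.lintegral_kernel_prod_right',
    lintegral_withDensity_eq_lintegral_mul _ (by fun_prop) hφ,
    Measure.lintegral_compProd (by fun_prop)]
  refine lintegral_congr fun x => ?_
  simp only [Pi.mul_apply]
  rw [lintegral_const_mul _ (by fun_prop)]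

end ConformalCausal

/-- coverage under the tilted covariate distribution, Equation (14) in
the appendix: for an arbitrary measurable weight function `ŵ : 𝒳 → [0,∞)` with
`E_{X ~ P_X}[ŵ(X)] = 1`, let `Q̃_X` be the tilted probability measure `dQ̃_X = ŵ dP_X`.
Then for a test pair `(X̃, Ỹ) ~ Q̃_X × P_{Y|X}` independent of the calibration sample, the
weighted split-CQR interval built with weight function `ŵ` satisfies
`P(Ỹ ∈ Ĉ(X̃)) ≥ 1 − α`. -/
theorem weighted_split_CQR_tilted_coverage
    {𝒳 : Type*} [MeasurableSpace 𝒳]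
    (P : Measure 𝒳) [IsProbabilityMeasure P]
    (K : Kernel 𝒳 ℝ) [IsMarkovKernel K]
    (α : ℝ) (hα : α ∈ Set.Ioo (0 : ℝ) 1)
    (qlo qhi : 𝒳 → ℝ) (hqlo : Measurable qlo) (hqhi : Measurable qhi)
    (wh : 𝒳 → ℝ≥0∞) (hwh : Measurable wh)
    -- `ŵ` takes values in `[0, ∞)`
    (hwfin : ∀ x, wh x ≠ ∞)
    -- normalization `E_{X ~ P_X}[ŵ(X)] = 1`
    (hnorm : (∫⁻ x, wh x ∂P) = 1)
    (n : ℕ) :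
    ENNReal.ofReal (1 - α) ≤
      ((Measure.pi fun _ : Fin n => P ⊗ₘ K).prod ((P.withDensity wh) ⊗ₘ K))
        {ω : (Fin n → 𝒳 × ℝ) × (𝒳 × ℝ) |
          ω.2.2 ∈ ConformalCausal.Chat α wh ω.1 qlo qhi ω.2.1} := by
  have hc1 : ENNReal.ofReal (1 - α) ≤ 1 := by
    rw [ENNReal.ofReal_le_one]; linarith [hα.1]
  rw [ConformalCausal.compProd_withDensity_left P K hwh]
  set c := ENNReal.ofReal (1 - α) with hc
  set μ : Measure (𝒳 × ℝ) := P ⊗ₘ K with hμ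
  have hW : Measurable fun z : 𝒳 × ℝ => wh z.1 := by fun_prop
  have hWint : ∫⁻ z, wh z.1 ∂μ = 1 := by
    rw [hμ, Measure.lintegral_compProd hW]
    simpa using hnorm
  let G := ConformalCausal.goodEvent c wh qlo qhi n
  have hG : MeasurableSet G := ConformalCausal.measurableSet_goodEvent c hwh hqlo hqhi n
  -- the weighted indicator of the good event
  let f : (𝒳 × ℝ) × (Fin n → 𝒳 × ℝ) → ℝ≥0∞ := G.indicator fun p => wh p.1.1
  have hf : Measurable f := Measurable.indicator (by fun_prop) hG
  let I := ∫⁻ p, f p ∂(μ.prod (Measure.pi fun _ : Fin n => μ))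
  have hI : I ≤ ((Measure.pi fun _ : Fin n => μ).prod (μ.withDensity fun z => wh z.1))
        {ω : (Fin n → 𝒳 × ℝ) × (𝒳 × ℝ) |
          ω.2.2 ∈ ConformalCausal.Chat α wh ω.1 qlo qhi ω.2.1} := by
    have hsub : Prod.swap ⁻¹' G ⊆ {ω : (Fin n → 𝒳 × ℝ) × (𝒳 × ℝ) |
          ω.2.2 ∈ ConformalCausal.Chat α wh ω.1 qlo qhi ω.2.1} :=
      fun ω hω => ConformalCausal.mem_Chat_of_good hω
    refine le_trans (le_of_eq ?_) (measure_mono hsub)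
    have : SFinite (μ.withDensity fun z => wh z.1) := inferInstance
    rw [prod_withDensity_right hW, withDensity_apply _ (measurable_swap hG),
      ← lintegral_indicator (measurable_swap hG)]
    change ∫⁻ p, f p ∂_ = _
    rw [← lintegral_prod_swap]
    rfl
  refine le_trans ?_ hI
  let M : Measure (Fin (n + 1) → 𝒳 × ℝ) := Measure.pi fun _ => μ
  let e (k : Fin (n + 1)) := MeasurableEquiv.piFinSuccAbove (fun _ : Fin (n + 1) => 𝒳 × ℝ) k
  have hek (k : Fin (n + 1)) :
      MeasurePreserving (e k) M (μ.prod (Measure.pi fun _ : Fin n => μ)) :=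
    measurePreserving_piFinSuccAbove (fun _ : Fin (n + 1) => μ) k
  have hIk (k : Fin (n + 1)) : ∫⁻ ζ, f (e k ζ) ∂M = I := (hek k).lintegral_comp hf
  have hfk (k : Fin (n + 1)) (ζ : Fin (n + 1) → 𝒳 × ℝ) :
      f (e k ζ) = if (∑ i, if ConformalCausal.score qlo qhi (ζ i) <
          ConformalCausal.score qlo qhi (ζ k) then wh (ζ i).1 else 0)
          < c * ∑ j, wh (ζ j).1 then wh (ζ k).1 else 0 := by
    have h1 : e k ζ = (ζ k, fun j => ζ (k.succAbove j)) := rfl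
    simp only [f, h1, Set.indicator_apply]
    refine if_congr ?_ rfl rfl
    simp only [G, ConformalCausal.goodEvent, Set.mem_ofPred_eq]
    rw [Fin.sum_univ_succAbove _ k, Fin.sum_univ_succAbove (fun j => wh (ζ j).1) k]
    simp [add_comm]
  have hmain : c * ∫⁻ ζ, ∑ j, wh (ζ j).1 ∂M ≤ ∫⁻ ζ, ∑ k, f (e k ζ) ∂M := by
    rw [← lintegral_const_mul _ (by fun_prop)]
    refine lintegral_mono fun ζ => ?_
    simp only [hfk]
    exact ConformalCausal.sum_good_ge c hc1 (fun j => wh (ζ j).1)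
      (fun j => ConformalCausal.score qlo qhi (ζ j))
  have hfm (k : Fin (n + 1)) : Measurable fun ζ => f (e k ζ) := hf.comp (e k).measurable
  rw [lintegral_finsetSum (f := fun k ζ => f (e k ζ)) _ (fun k _ => hfm k),
    lintegral_finsetSum _ (fun k _ => by fun_prop)] at hmain
  have hwk (k : Fin (n + 1)) : ∫⁻ ζ, wh (ζ k).1 ∂M = 1 := by
    rw [← hWint]
    exact (measurePreserving_eval (fun _ : Fin (n + 1) => μ) k).lintegral_comp hW
  simp only [hIk, hwk, Finset.sum_const, Finset.card_univ, Fintype.card_fin, nsmul_eq_mul,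
    mul_one] at hmain
  rw [mul_comm] at hmain
  exact (ENNReal.mul_le_mul_iff_right (by simp) (ENNReal.natCast_ne_top _)).1 hmain
end
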